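/- For every j ∈ {2,3,4} and λ ∈ {1,-1}, there exists a smooth function m : ℝ³ → ℝ such that L₁N(s,t,w) = m(s,t,w)·N(s,t,w) for all (s,t,w) ∈ ℝ³ if and only if k₁ is identically zero; moreover, in that case necessarily m is the constant 2·λ^{j+1}·σ/r³, i.e. L₁N = (2λ^{j+1}σ/r³)·N. In other words, the tubular hypersurface has first kind L₁-(global) pointwise 1-type Gauss map exactly when k₁ = 0, with m = 2λ^{j+1}σ/r³. -/

import Mathlib

noncomputable section

open Real

set_option linter.unusedVariables false

/-- Minkowski inner product on `ℝ⁴` with signature `(-,+,+,+)`. -/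
def mink (u v : Fin 4 → ℝ) : ℝ :=
  -(u 0 * v 0) + u 1 * v 1 + u 2 * v 2 + u 3 * v 3

/-- `εᵢ = ⟨Fᵢ,Fᵢ⟩` : equals `-1` if `i = j` and `1` otherwise. -/
def eps (j i : ℕ) : ℝ := if i = j then -1 else 1

/-- `σ = 1` if `j = 2` and `σ = -1` if `j ∈ {3,4}`. -/
def sigma' (j : ℕ) : ℝ := if j = 2 then 1 else -1

/-- `τ = 1` if `j ∈ {2,3}` and `τ = -1` if `j = 4`. -/
def tau' (j : ℕ) : ℝ := if j = 4 then -1 else 1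

/-- The functions `μ₂, μ₃, μ₄` defined by the cyclic index rule
(`μ₅ := μ₂`, `μ₆ := μ₃`): `μⱼ = cosh t·sinh w`, `μⱼ₊₁ = cosh w`,
`μⱼ₊₂ = sinh t·sinh w` if `λ = 1`, and `μⱼ = cosh t·cosh w`,
`μⱼ₊₁ = sinh w`, `μⱼ₊₂ = sinh t·cosh w` if `λ = -1`. -/
def mu (j : ℕ) (lam : ℝ) (i : ℕ) (t w : ℝ) : ℝ :=
  if (i + 3 - j) % 3 = 0 then cosh t * (if lam = 1 then sinh w else cosh w)
  else if (i + 3 - j) % 3 = 1 then (if lam = 1 then cosh w else sinh w)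
  else sinh t * (if lam = 1 then sinh w else cosh w)

/-- Gauss map of the tubular hypersurface `T^{j,λ}` about a spacelike curve of type `j`. -/
def gaussNJ (j : ℕ) (lam : ℝ) (F₂ F₃ F₄ : ℝ → Fin 4 → ℝ) (s t w : ℝ) : Fin 4 → ℝ :=
  (-(sigma' j) * lam ^ j) •
    (mu j lam 2 t w • F₂ s + mu j lam 3 t w • F₃ s + mu j lam 4 t w • F₄ s)

/-- The tubular hypersurface `T^{j,λ}` about a spacelike curve of type `j`. -/
def tubeTJ (j : ℕ) (lam r : ℝ) (β F₂ F₃ F₄ : ℝ → Fin 4 → ℝ) (s t w : ℝ) : Fin 4 → ℝ :=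
  β s + r • (mu j lam 2 t w • F₂ s + mu j lam 3 t w • F₃ s + mu j lam 4 t w • F₄ s)

/-- The function `D(s,t,w) = σ + r k₁(s) μ₂(t,w)`. -/
def DJ (j : ℕ) (lam r : ℝ) (k₁ : ℝ → ℝ) (s t w : ℝ) : ℝ :=
  sigma' j + r * k₁ s * mu j lam 2 t w

/-- The Cheng–Yau operator `ℒ₁` applied to the Gauss map of `T^{j,λ}`. -/
def L1NJ (j : ℕ) (lam r : ℝ) (k₁ k₂ : ℝ → ℝ) (F₁ F₂ F₃ F₄ : ℝ → Fin 4 → ℝ)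
    (s t w : ℝ) : Fin 4 → ℝ :=
  (2 * (-(tau' j) * k₁ s * k₂ s * mu j lam 3 t w + deriv k₁ s * mu j lam 2 t w)
      / (r * (DJ j lam r k₁ s t w) ^ 3)) • F₁ s
  + (-2 * lam * (mu j lam 2 t w + 3 * r ^ 2 * (k₁ s) ^ 2 * (mu j lam 2 t w) ^ 3
      + k₁ s * (lam * r + 4 * sigma' j * r * (mu j lam 2 t w) ^ 2))
      / (r ^ 3 * (DJ j lam r k₁ s t w) ^ 2)) • F₂ s
  + (-2 * lam * sigma' j * mu j lam 3 t w * (1 + 3 * sigma' j * r * k₁ s * mu j lam 2 t w)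
      / (r ^ 3 * DJ j lam r k₁ s t w)) • F₃ s
  + (-2 * lam * mu j lam 4 t w * (sigma' j + 3 * r * k₁ s * mu j lam 2 t w)
      / (r ^ 3 * DJ j lam r k₁ s t w)) • F₄ s

/-- The operator `ℒ₂` applied to the Gauss map of `T^{j,λ}`. -/
def L2NJ (j : ℕ) (lam r : ℝ) (k₁ k₂ : ℝ → ℝ) (F₁ F₂ F₃ F₄ : ℝ → Fin 4 → ℝ)
    (s t w : ℝ) : Fin 4 → ℝ :=
  (lam ^ j * ((-1 : ℝ) ^ j * mu j lam 3 t w * k₁ s * k₂ s - sigma' j * mu j lam 2 t w * deriv k₁ s)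
      / (r ^ 2 * (DJ j lam r k₁ s t w) ^ 3)) • F₁ s
  + (-lam ^ (j + 1) * k₁ s * (2 * lam * sigma' j - 3 * (-1 : ℝ) ^ j * (mu j lam 4 t w) ^ 2
      - 3 * tau' j * (mu j lam 3 t w) ^ 2 - 3 * sigma' j * r * k₁ s * (mu j lam 2 t w) ^ 3)
      / (r ^ 3 * (DJ j lam r k₁ s t w) ^ 2)) • F₂ s
  + (3 * tau' j * lam ^ (j + 1) * r * k₁ s * mu j lam 2 t w * mu j lam 3 t w
      / (r ^ 4 * (tau' j + (-1 : ℝ) ^ j * r * k₁ s * mu j lam 2 t w))) • F₃ s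
  + (3 * tau' j * lam ^ (j + 1) * r * k₁ s * mu j lam 2 t w * mu j lam 4 t w
      / (r ^ 4 * (tau' j + (-1 : ℝ) ^ j * r * k₁ s * mu j lam 2 t w))) • F₄ s

theorem mink_comm (u v : Fin 4 → ℝ) : mink u v = mink v u := by
  simp only [mink]; ring

theorem mink_lincomb_left (a b c d : ℝ) (u₁ u₂ u₃ u₄ v : Fin 4 → ℝ) :
    mink (a • u₁ + b • u₂ + c • u₃ + d • u₄) v
      = a * mink u₁ v + b * mink u₂ v + c * mink u₃ v + d * mink u₄ v := by
  simp only [mink, Pi.add_apply, Pi.smul_apply, smul_eq_mul]; ring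

theorem eps_ne_zero (j i : ℕ) : eps j i ≠ 0 := by
  unfold eps; split_ifs <;> norm_num

/-- Coefficients with respect to an orthogonal frame of non-null vectors are unique. -/
theorem coeff_eq_of_mink_orthogonal {u₁ u₂ u₃ u₄ : Fin 4 → ℝ}
    (h₂₂ : mink u₂ u₂ ≠ 0) (h₃₃ : mink u₃ u₃ ≠ 0) (h₄₄ : mink u₄ u₄ ≠ 0)
    (h₁₂ : mink u₁ u₂ = 0) (h₁₃ : mink u₁ u₃ = 0) (h₁₄ : mink u₁ u₄ = 0)
    (h₂₃ : mink u₂ u₃ = 0) (h₂₄ : mink u₂ u₄ = 0) (h₃₄ : mink u₃ u₄ = 0)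
    {a b c d m q x y z : ℝ}
    (h : a • u₁ + b • u₂ + c • u₃ + d • u₄ = m • q • (x • u₂ + y • u₃ + z • u₄)) :
    b = m * q * x ∧ c = m * q * y ∧ d = m * q * z := by
  have h₃₂ := (mink_comm u₃ u₂).trans h₂₃
  have h₄₂ := (mink_comm u₄ u₂).trans h₂₄
  have h₄₃ := (mink_comm u₄ u₃).trans h₃₄
  have key : a • u₁ + b • u₂ + c • u₃ + d • u₄
      = (0 : ℝ) • u₁ + (m * q * x) • u₂ + (m * q * y) • u₃ + (m * q * z) • u₄ := by
    rw [h]; module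
  have key' := fun v => congrArg (mink · v) key
  simp only [mink_lincomb_left] at key'
  refine ⟨mul_right_cancel₀ h₂₂ ?_, mul_right_cancel₀ h₃₃ ?_, mul_right_cancel₀ h₄₄ ?_⟩
  · simpa [h₁₂, h₃₂, h₄₂] using key' u₂
  · simpa [h₁₃, h₂₃, h₄₃] using key' u₃
  · simpa [h₁₄, h₂₄, h₃₄] using key' u₄

theorem sigma'_mul_self (j : ℕ) : sigma' j * sigma' j = 1 := by
  unfold sigma'; split_ifs <;> norm_num

theorem mu_one_one_pos (j : ℕ) (lam : ℝ) (i : ℕ) : 0 < mu j lam i 1 1 := by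
  have hs : 0 < sinh 1 := sinh_pos_iff.2 one_pos
  have hc : 0 < cosh 1 := cosh_pos 1
  unfold mu; split_ifs <;> positivity

theorem exists_mu_ne_zero {j : ℕ} (hj : j = 2 ∨ j = 3 ∨ j = 4) (lam t w : ℝ) :
    mu j lam 2 t w ≠ 0 ∨ mu j lam 3 t w ≠ 0 ∨ mu j lam 4 t w ≠ 0 := by
  have ht := (cosh_pos t).ne'
  have hw := (cosh_pos w).ne'
  by_cases hl : lam = 1 <;> rcases hj with rfl | rfl | rfl <;> simp [mu, hl, ht, hw]

/-- Where `k₁` vanishes, `ℒ₁N` is the stated multiple of `N`. -/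
theorem L1NJ_eq_of_k₁_eq_zero {j : ℕ} {lam : ℝ} (hlam : lam * lam = 1) {r : ℝ} (hr : r ≠ 0)
    {k₁ : ℝ → ℝ} (hk₁ : ∀ s, k₁ s = 0) (k₂ : ℝ → ℝ) (F₁ F₂ F₃ F₄ : ℝ → Fin 4 → ℝ) (s t w : ℝ) :
    L1NJ j lam r k₁ k₂ F₁ F₂ F₃ F₄ s t w
      = (2 * lam ^ (j + 1) * sigma' j / r ^ 3) • gaussNJ j lam F₂ F₃ F₄ s t w := by
  obtain rfl : k₁ = fun _ => 0 := funext hk₁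
  have hσ := sigma'_mul_self j
  have hσ0 : sigma' j ≠ 0 := left_ne_zero_of_mul_eq_one hσ
  have hl : lam ^ j * lam ^ j = 1 := by rw [← mul_pow, hlam, one_pow]
  have hcoef : 2 * lam ^ (j + 1) * sigma' j / r ^ 3 * (-(sigma' j) * lam ^ j)
      = -2 * lam / r ^ 3 := by
    rw [div_mul_eq_mul_div, pow_succ]
    congr 1
    linear_combination (-2 * lam * (sigma' j * sigma' j)) * hl - 2 * lam * hσ
  have h₂ (x : ℝ) : -2 * lam * x / (r ^ 3 * sigma' j ^ 2) = -2 * lam / r ^ 3 * x := by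
    rw [pow_two, hσ]; ring
  have h₃ (x : ℝ) : -2 * lam * sigma' j * x / (r ^ 3 * sigma' j) = -2 * lam / r ^ 3 * x := by
    field_simp
  have h₄ (x : ℝ) : -2 * lam * x * sigma' j / (r ^ 3 * sigma' j) = -2 * lam / r ^ 3 * x := by
    field_simp
  unfold L1NJ gaussNJ DJ
  rw [smul_smul, hcoef]
  simp only [deriv_const', mul_zero, zero_mul, add_zero, zero_div, zero_smul, zero_add, mul_one,
    ne_eq, OfNat.ofNat_ne_zero, not_false_eq_true, zero_pow, h₂, h₃, h₄]
  module

theorem first_kind_L1_pointwise_one_type_gauss_map_spacelike_iff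
    (j : ℕ) (hj : j = 2 ∨ j = 3 ∨ j = 4) (lam : ℝ) (hlam : lam = 1 ∨ lam = -1)
    (r : ℝ) (hr : 0 < r)
    (β F₁ F₂ F₃ F₄ : ℝ → Fin 4 → ℝ) (k₁ k₂ k₃ : ℝ → ℝ)
    (hβ : ContDiff ℝ (⊤ : ℕ∞) β) (hF₁ : ContDiff ℝ (⊤ : ℕ∞) F₁) (hF₂ : ContDiff ℝ (⊤ : ℕ∞) F₂)
    (hF₃ : ContDiff ℝ (⊤ : ℕ∞) F₃) (hF₄ : ContDiff ℝ (⊤ : ℕ∞) F₄)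
    (hk₁ : ContDiff ℝ (⊤ : ℕ∞) k₁) (hk₂ : ContDiff ℝ (⊤ : ℕ∞) k₂) (hk₃ : ContDiff ℝ (⊤ : ℕ∞) k₃)
    (hβ' : ∀ s, deriv β s = F₁ s)
    (hF₁₁ : ∀ s, mink (F₁ s) (F₁ s) = eps j 1)
    (hF₂₂ : ∀ s, mink (F₂ s) (F₂ s) = eps j 2)
    (hF₃₃ : ∀ s, mink (F₃ s) (F₃ s) = eps j 3)
    (hF₄₄ : ∀ s, mink (F₄ s) (F₄ s) = eps j 4)
    (hF₁₂ : ∀ s, mink (F₁ s) (F₂ s) = 0)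
    (hF₁₃ : ∀ s, mink (F₁ s) (F₃ s) = 0)
    (hF₁₄ : ∀ s, mink (F₁ s) (F₄ s) = 0)
    (hF₂₃ : ∀ s, mink (F₂ s) (F₃ s) = 0)
    (hF₂₄ : ∀ s, mink (F₂ s) (F₄ s) = 0)
    (hF₃₄ : ∀ s, mink (F₃ s) (F₄ s) = 0)
    (hFr₁ : ∀ s, deriv F₁ s = k₁ s • F₂ s)
    (hFr₂ : ∀ s, deriv F₂ s = (-(eps j 1 * eps j 2) * k₁ s) • F₁ s + k₂ s • F₃ s)
    (hFr₃ : ∀ s, deriv F₃ s = (-(eps j 2 * eps j 3) * k₂ s) • F₂ s + k₃ s • F₄ s)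
    (hFr₄ : ∀ s, deriv F₄ s = (-(eps j 3 * eps j 4) * k₃ s) • F₃ s)
    (hD : ∀ s t w : ℝ, DJ j lam r k₁ s t w ≠ 0)
    :
    ((∃ m : ℝ × ℝ × ℝ → ℝ, ContDiff ℝ (⊤ : ℕ∞) m ∧
        ∀ s t w : ℝ, L1NJ j lam r k₁ k₂ F₁ F₂ F₃ F₄ s t w = m (s, t, w) • gaussNJ j lam F₂ F₃ F₄ s t w)
      ↔ (∀ s, k₁ s = 0)) ∧
    (∀ m : ℝ × ℝ × ℝ → ℝ, ContDiff ℝ (⊤ : ℕ∞) m →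
      (∀ s t w : ℝ, L1NJ j lam r k₁ k₂ F₁ F₂ F₃ F₄ s t w = m (s, t, w) • gaussNJ j lam F₂ F₃ F₄ s t w) →
      ∀ p, m p = 2 * lam ^ (j + 1) * sigma' j / r ^ 3) := by
  have hll : lam * lam = 1 := by rcases hlam with rfl | rfl <;> norm_num
  have hlam0 : lam ≠ 0 := left_ne_zero_of_mul_eq_one hll
  have hcoeff {m : ℝ × ℝ × ℝ → ℝ} (hm : ∀ s t w : ℝ, L1NJ j lam r k₁ k₂ F₁ F₂ F₃ F₄ s t w
      = m (s, t, w) • gaussNJ j lam F₂ F₃ F₄ s t w) (s t w : ℝ) :=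
    coeff_eq_of_mink_orthogonal (hF₂₂ s ▸ eps_ne_zero j 2) (hF₃₃ s ▸ eps_ne_zero j 3)
      (hF₄₄ s ▸ eps_ne_zero j 4) (hF₁₂ s) (hF₁₃ s) (hF₁₄ s) (hF₂₃ s) (hF₂₄ s) (hF₃₄ s) (hm s t w)
  have hk₁_zero {m : ℝ × ℝ × ℝ → ℝ} (hm : ∀ s t w : ℝ, L1NJ j lam r k₁ k₂ F₁ F₂ F₃ F₄ s t w
      = m (s, t, w) • gaussNJ j lam F₂ F₃ F₄ s t w) (s : ℝ) : k₁ s = 0 := by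
    obtain ⟨h₂, -, h₄⟩ := hcoeff hm s 1 1
    have hμ := (mu_one_one_pos j lam 4).ne'
    have hd := hD s 1 1
    have hσ := sigma'_mul_self j
    generalize hx : mu j lam 2 1 1 = x at *
    generalize mu j lam 4 1 1 = z at *
    have hdef : DJ j lam r k₁ s 1 1 = sigma' j + r * k₁ s * x := by rw [DJ, hx]
    generalize DJ j lam r k₁ s 1 1 = D at *
    generalize sigma' j = σ at *
    have hr0 := hr.ne'
    rw [div_eq_iff (by positivity)] at h₂ h₄
    have h : k₁ s * (lam * lam * r * z) = 0 := by
      rw [hdef] at h₂ h₄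
      linear_combination (-z / 2) * h₂ + (x * (σ + r * k₁ s * x) / 2) * h₄ + (lam * x * z) * hσ
    simpa [hlam0, hr0, hμ] using h
  refine ⟨⟨fun ⟨m, _, hm⟩ => hk₁_zero hm, fun h => ⟨fun _ => 2 * lam ^ (j + 1) * sigma' j / r ^ 3,
    contDiff_const, L1NJ_eq_of_k₁_eq_zero hll hr.ne' h k₂ F₁ F₂ F₃ F₄⟩⟩, ?_⟩
  rintro m - hm ⟨s, t, w⟩
  have hk := hk₁_zero hm
  have hN : m (s, t, w) • gaussNJ j lam F₂ F₃ F₄ s t w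
      = (2 * lam ^ (j + 1) * sigma' j / r ^ 3) • gaussNJ j lam F₂ F₃ F₄ s t w := by
    rw [← hm, L1NJ_eq_of_k₁_eq_zero hll hr.ne' hk]
  refine smul_left_injective ℝ (fun h0 => ?_) hN
  have h0' : (0 : ℝ) • F₁ s + (0 : ℝ) • F₂ s + (0 : ℝ) • F₃ s + (0 : ℝ) • F₄ s
      = (1 : ℝ) • gaussNJ j lam F₂ F₃ F₄ s t w := by simp [h0]
  obtain ⟨h₂, h₃, h₄⟩ := coeff_eq_of_mink_orthogonal (hF₂₂ s ▸ eps_ne_zero j 2)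
    (hF₃₃ s ▸ eps_ne_zero j 3) (hF₄₄ s ▸ eps_ne_zero j 4) (hF₁₂ s) (hF₁₃ s) (hF₁₄ s) (hF₂₃ s)
    (hF₂₄ s) (hF₃₄ s) h0'
  have hq : 1 * (-(sigma' j) * lam ^ j) ≠ 0 := by
    have hσ0 : sigma' j ≠ 0 := left_ne_zero_of_mul_eq_one (sigma'_mul_self j)
    simp [hσ0, hlam0]
  rcases exists_mu_ne_zero hj lam t w with h | h | h
  · exact mul_ne_zero hq h h₂.symm
  · exact mul_ne_zero hq h h₃.symm
  · exact mul_ne_zero hq h h₄.symm
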